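/- arXiv:2402.06426 — 2 statements merged into one kernel-verified Lean document; each statement's English description precedes it below -/
import Mathlib

section
/- Let P > 100 and set K_P = (log P)^{1.01}. Then for P sufficiently large, ∑_{n > P^{log log P}, P(n) ≤ P} 1/n ≪ (log P)^{0.99}, where P(n) is the largest prime factor of n. -/
open scoped Classical

/-- If `g p ≤ a * log p` for all primes `p ∈ (2 ^ k, 2 ^ (k + 1)]`, then by Chebyshev's bound these
primes contribute at most `a * (log 4 * 2 ^ (k + 1))` to the sum of `g`. -/
lemma sum_primesLE_two_pow_succ_le {g : ℕ → ℝ} {a : ℝ} (ha : 0 ≤ a) (k : ℕ)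
    (hg : ∀ p : ℕ, p.Prime → 2 ^ k < p → g p ≤ a * Real.log p) :
    ∑ p ∈ Nat.primesLE (2 ^ (k + 1)), g p ≤
      ∑ p ∈ Nat.primesLE (2 ^ k), g p + a * (Real.log 4 * 2 ^ (k + 1)) := by
  rw [← Finset.sum_filter_add_sum_filter_not (Nat.primesLE (2 ^ (k + 1))) (fun p => p ≤ 2 ^ k)]
  have hlow : (Nat.primesLE (2 ^ (k + 1))).filter (fun p => p ≤ 2 ^ k) =
      Nat.primesLE (2 ^ k) := by
    ext p
    simp only [Finset.mem_filter, Nat.mem_primesLE, pow_succ]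
    grind
  rw [hlow]
  gcongr
  calc ∑ p ∈ (Nat.primesLE (2 ^ (k + 1))).filter (fun p => ¬ p ≤ 2 ^ k), g p
      ≤ ∑ p ∈ (Nat.primesLE (2 ^ (k + 1))).filter (fun p => ¬ p ≤ 2 ^ k), a * Real.log p := by
        refine Finset.sum_le_sum fun p hp => ?_
        rw [Finset.mem_filter] at hp
        exact hg p (Nat.prime_of_mem_primesLE hp.1) (not_le.mp hp.2)
    _ ≤ ∑ p ∈ Nat.primesLE (2 ^ (k + 1)), a * Real.log p := by
        refine Finset.sum_le_sum_of_subset_of_nonneg (Finset.filter_subset _ _) fun p hp _ => ?_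
        exact mul_nonneg ha (Real.log_natCast_nonneg p)
    _ ≤ a * (Real.log 4 * 2 ^ (k + 1)) := by
        rw [← Finset.mul_sum, ← Chebyshev.theta_eq_sum_primesLE_log]
        gcongr
        simpa using Chebyshev.theta_le_log4_mul_x (x := ((2 ^ (k + 1) : ℕ) : ℝ)) (by positivity)

lemma log_four_eq : Real.log 4 = 2 * Real.log 2 := by
  rw [show (4 : ℝ) = 2 ^ 2 by norm_num, Real.log_pow]
  norm_num

lemma sum_log_div_primesLE_two_pow_le (K : ℕ) :
    ∑ p ∈ Nat.primesLE (2 ^ K), Real.log p / p ≤ 4 * Real.log 2 * K := by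
  induction K with
  | zero => simp
  | succ k ih =>
    have h := sum_primesLE_two_pow_succ_le (g := fun p => Real.log p / p) (a := 1 / 2 ^ k)
      (by positivity) k fun p hp hkp => by
        have hkp' : (2 : ℝ) ^ k ≤ p := by exact_mod_cast hkp.le
        rw [div_eq_mul_one_div, mul_comm]
        gcongr
    have he : 1 / 2 ^ k * (Real.log 4 * 2 ^ (k + 1)) = 4 * Real.log 2 := by
      rw [log_four_eq, pow_succ]
      field_simp
      norm_num
    rw [he] at h
    push_cast
    linarith

lemma sum_one_div_primesLE_two_pow_le (K : ℕ) :
    ∑ p ∈ Nat.primesLE (2 ^ K), (1 : ℝ) / p ≤ 8 * (harmonic K : ℝ) := by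
  induction K with
  | zero => simp
  | succ k ih =>
    have hl2 : 0 < Real.log 2 := Real.log_pos one_lt_two
    have h := sum_primesLE_two_pow_succ_le (g := fun p => 1 / (p : ℝ))
      (a := 2 / ((k + 1) * Real.log 2 * 2 ^ k)) (by positivity) k fun p hp hkp => by
        have hkp' : (2 : ℝ) ^ k ≤ p := by exact_mod_cast hkp.le
        have hlog : (k + 1) / 2 * Real.log 2 ≤ Real.log p := by
          rcases Nat.eq_zero_or_pos k with rfl | hk
          · have : Real.log 2 ≤ Real.log p :=
              Real.log_le_log two_pos (by exact_mod_cast hp.two_le)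
            push_cast
            linarith
          · have h1 : Real.log (2 ^ k) ≤ Real.log p := Real.log_le_log (by positivity) hkp'
            rw [Real.log_pow] at h1
            have hk' : (1 : ℝ) ≤ k := by exact_mod_cast hk
            nlinarith
        calc (1 : ℝ) / p ≤ 1 / 2 ^ k := by gcongr
          _ = 2 / ((k + 1) * Real.log 2 * 2 ^ k) * ((k + 1) / 2 * Real.log 2) := by
            field_simp
          _ ≤ _ := by gcongr
    have he : 2 / ((k + 1) * Real.log 2 * 2 ^ k) * (Real.log 4 * 2 ^ (k + 1)) =
        8 * ((k : ℝ) + 1)⁻¹ := by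
      rw [log_four_eq, pow_succ]
      field_simp
      norm_num
    rw [he] at h
    rw [harmonic_succ]
    push_cast
    linarith

/-- The completely multiplicative function `n ↦ n ^ s`. -/
noncomputable def natRpowHom (s : ℝ) : ℕ →* ℝ where
  toFun n := (n : ℝ) ^ s
  map_one' := by simp
  map_mul' m n := by
    push_cast
    exact Real.mul_rpow (Nat.cast_nonneg m) (Nat.cast_nonneg n)

lemma inv_one_sub_le_exp {x : ℝ} (hx0 : 0 ≤ x) (hx : x ≤ 3 / 4) :
    (1 - x)⁻¹ ≤ Real.exp (4 * x) := by
  have h1 : (1 - x)⁻¹ ≤ 4 * x + 1 := by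
    rw [inv_le_iff_one_le_mul₀ (by linarith)]
    nlinarith
  exact h1.trans (Real.add_one_le_exp _)

lemma exp_le_one_add_mul_exp (x : ℝ) : Real.exp x ≤ 1 + x * Real.exp x := by
  have h := Real.add_one_le_exp (-x)
  have h2 := mul_le_mul_of_nonneg_right h (Real.exp_pos x).le
  rw [← Real.exp_add, neg_add_cancel, Real.exp_zero] at h2
  linarith

lemma two_rpow_neg_half_le : (2 : ℝ) ^ (-(1 / 2) : ℝ) ≤ 3 / 4 := by
  rw [Real.rpow_neg two_pos.le, ← Real.sqrt_eq_rpow]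
  have h : (4 / 3 : ℝ) ≤ √2 := Real.le_sqrt_of_sq_le (by norm_num)
  exact (inv_anti₀ (by norm_num) h).trans (by norm_num)

lemma prime_rpow_le {p : ℕ} (hp : p.Prime) {s : ℝ} (hs : s ≤ -(1 / 2)) :
    (p : ℝ) ^ s ≤ 3 / 4 := by
  have h2 : (2 : ℝ) ≤ p := by exact_mod_cast hp.two_le
  calc (p : ℝ) ^ s ≤ (p : ℝ) ^ (-(1 / 2) : ℝ) :=
        Real.rpow_le_rpow_of_exponent_le (by linarith) hs
    _ ≤ (2 : ℝ) ^ (-(1 / 2) : ℝ) := Real.rpow_le_rpow_of_nonpos two_pos h2 (by norm_num)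
    _ ≤ 3 / 4 := two_rpow_neg_half_le

/-- Rankin's upper bound for the Euler product over primes up to `2 ^ K`, shifted by `32 / L`. -/
lemma sum_rpow_primesLE_two_pow_le {L : ℝ} (hL : 64 ≤ L) {K : ℕ} (hK0 : 0 < K)
    (hK : (K : ℝ) ≤ 2 * L) :
    ∑ p ∈ Nat.primesLE (2 ^ K), (p : ℝ) ^ (-1 + 32 / L) ≤
      8 * Real.log L + (16 + 256 * Real.exp 64) := by
  have hLpos : 0 < L := by linarith
  have hl2 : 0 < Real.log 2 := Real.log_pos one_lt_two
  have hl2' : Real.log 2 ≤ 1 := by linarith [Real.log_two_lt_d9]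
  have hterm : ∀ p ∈ Nat.primesLE (2 ^ K), (p : ℝ) ^ (-1 + 32 / L) ≤
      1 / p + 32 * Real.exp 64 / L * (Real.log p / p) := by
    intro p hp
    have hpp := Nat.prime_of_mem_primesLE hp
    have hp0 : (0 : ℝ) < p := by exact_mod_cast hpp.pos
    have hlogp : Real.log p ≤ 2 * L := by
      calc Real.log p ≤ Real.log (2 ^ K) :=
            Real.log_le_log hp0 (by exact_mod_cast Nat.le_of_mem_primesLE hp)
        _ = K * Real.log 2 := Real.log_pow ..
        _ ≤ K * 1 := by gcongr
        _ ≤ 2 * L := by linarith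
    have hlog0 : 0 ≤ Real.log p := Real.log_natCast_nonneg p
    rw [Real.rpow_add hp0, Real.rpow_neg_one, Real.rpow_def_of_pos hp0]
    have hx : Real.log p * (32 / L) ≤ 64 := by
      calc Real.log p * (32 / L) ≤ 2 * L * (32 / L) := by gcongr
        _ = 64 := by field_simp; norm_num
    calc (p : ℝ)⁻¹ * Real.exp (Real.log p * (32 / L))
        ≤ (p : ℝ)⁻¹ * (1 + Real.log p * (32 / L) * Real.exp (Real.log p * (32 / L))) := by
          gcongr
          exact exp_le_one_add_mul_exp _
      _ ≤ (p : ℝ)⁻¹ * (1 + Real.log p * (32 / L) * Real.exp 64) := by gcongr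
      _ = _ := by field_simp
  refine (Finset.sum_le_sum hterm).trans ?_
  rw [Finset.sum_add_distrib, ← Finset.mul_sum]
  have hR : ∑ p ∈ Nat.primesLE (2 ^ K), (1 : ℝ) / p ≤ 8 * Real.log L + 16 := by
    have h1 := sum_one_div_primesLE_two_pow_le K
    have h2 := harmonic_le_one_add_log K
    have h3 : Real.log K ≤ Real.log 2 + Real.log L := by
      rw [← Real.log_mul two_ne_zero hLpos.ne']
      exact Real.log_le_log (by exact_mod_cast hK0) hK
    linarith
  have hS : 32 * Real.exp 64 / L * ∑ p ∈ Nat.primesLE (2 ^ K), Real.log p / p ≤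
      256 * Real.exp 64 := by
    calc 32 * Real.exp 64 / L * ∑ p ∈ Nat.primesLE (2 ^ K), Real.log p / p
        ≤ 32 * Real.exp 64 / L * (4 * Real.log 2 * K) := by
          gcongr
          exact sum_log_div_primesLE_two_pow_le K
      _ ≤ 32 * Real.exp 64 / L * (4 * 1 * (2 * L)) := by gcongr
      _ = 256 * Real.exp 64 := by field_simp; norm_num
  linarith

theorem stmt_8 : ∃ C > (0 : ℝ), ∃ P₀ : ℝ, ∀ P : ℝ, 100 < P → P₀ ≤ P →
    (∑' n : ℕ, if P ^ Real.log (Real.log P) < (n : ℝ) ∧ ∀ p ∈ n.primeFactors, (p : ℝ) ≤ P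
      then (1 : ℝ) / n else 0) ≤ C * Real.log P ^ (0.99 : ℝ) := by
  refine ⟨Real.exp (4 * (16 + 256 * Real.exp 64)), Real.exp_pos _, Real.exp 64, ?_⟩
  intro P hP hP₀
  have hPpos : 0 < P := by linarith
  obtain ⟨L, hLdef⟩ : ∃ L, L = Real.log P := ⟨_, rfl⟩
  rw [← hLdef]
  have hL : 64 ≤ L := hLdef ▸ (Real.le_log_iff_exp_le hPpos).mpr hP₀
  have hLpos : 0 < L := by linarith
  have hl2 : 0 < Real.log 2 := Real.log_pos one_lt_two
  have hl2' : 0.69 ≤ Real.log 2 := by linarith [Real.log_two_gt_d9]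
  set K := ⌈L / Real.log 2⌉₊ with hKdef
  have hK0 : 0 < K := Nat.ceil_pos.mpr (by positivity)
  have hK : (K : ℝ) ≤ 2 * L := by
    have h1 : (K : ℝ) < L / Real.log 2 + 1 := Nat.ceil_lt_add_one (by positivity)
    have h2 : L / Real.log 2 ≤ L / 0.69 := by gcongr
    have h3 : L / 0.69 + 1 ≤ 2 * L := by norm_num; linarith
    linarith
  have hPK : P ≤ 2 ^ K := by
    rw [← Real.log_le_log_iff hPpos (by positivity), Real.log_pow, ← hLdef]
    exact (div_le_iff₀ hl2).mp (Nat.le_ceil _)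
  set s : ℝ := -1 + 32 / L with hs
  have hδ : 32 / L ≤ 1 / 2 := by
    rw [div_le_iff₀ hLpos]
    linarith
  have hs' : s ≤ -(1 / 2) := by linarith
  set N := 2 ^ K + 1 with hN
  obtain ⟨-, hsum⟩ := EulerProduct.summable_and_hasSum_smoothNumbers_prod_primesBelow_geometric
    (f := natRpowHom s) (fun {p} hp => by
      change ‖(p : ℝ) ^ s‖ < 1
      rw [Real.norm_of_nonneg (by positivity)]
      linarith [prime_rpow_le hp hs']) N
  change HasSum (fun m : N.smoothNumbers => ((m : ℕ) : ℝ) ^ s)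
    (∏ p ∈ Nat.primesLE (2 ^ K), (1 - (p : ℝ) ^ s)⁻¹) at hsum
  have hprod : ∏ p ∈ Nat.primesLE (2 ^ K), (1 - (p : ℝ) ^ s)⁻¹ ≤
      Real.exp (4 * (16 + 256 * Real.exp 64)) * L ^ (32 : ℝ) := by
    calc ∏ p ∈ Nat.primesLE (2 ^ K), (1 - (p : ℝ) ^ s)⁻¹
        ≤ ∏ p ∈ Nat.primesLE (2 ^ K), Real.exp (4 * (p : ℝ) ^ s) := by
          refine Finset.prod_le_prod (fun p hp => ?_) fun p hp => ?_
          · have := prime_rpow_le (Nat.prime_of_mem_primesLE hp) hs'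
            exact inv_nonneg.mpr (by linarith)
          · exact inv_one_sub_le_exp (by positivity)
              (prime_rpow_le (Nat.prime_of_mem_primesLE hp) hs')
      _ = Real.exp (4 * ∑ p ∈ Nat.primesLE (2 ^ K), (p : ℝ) ^ s) := by
          rw [← Real.exp_sum, Finset.mul_sum]
      _ ≤ Real.exp (4 * (8 * Real.log L + (16 + 256 * Real.exp 64))) := by
          gcongr
          exact sum_rpow_primesLE_two_pow_le hL hK0 hK
      _ = _ := by
          rw [Real.rpow_def_of_pos hLpos, ← Real.exp_add]
          congr 1
          ring
  have hind : HasSum (N.smoothNumbers.indicator fun n : ℕ => (n : ℝ) ^ s)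
      (∏ p ∈ Nat.primesLE (2 ^ K), (1 - (p : ℝ) ^ s)⁻¹) :=
    hasSum_subtype_iff_indicator.mp hsum
  have hind' := hind.mul_right (L ^ (-32 : ℝ))
  have hle : ∀ n : ℕ, (if P ^ Real.log L < (n : ℝ) ∧ ∀ p ∈ n.primeFactors, (p : ℝ) ≤ P
      then (1 : ℝ) / n else 0) ≤
      N.smoothNumbers.indicator (fun n : ℕ => (n : ℝ) ^ s) n * L ^ (-32 : ℝ) := by
    intro n
    split_ifs with h
    · obtain ⟨hn, hsm⟩ := h
      have hn0 : (0 : ℝ) < n := (Real.rpow_pos_of_pos hPpos _).trans hn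
      have hmem : n ∈ N.smoothNumbers := by
        rw [Nat.mem_smoothNumbers]
        refine ⟨by exact_mod_cast hn0.ne', fun p hp => ?_⟩
        have h1 := (hsm p (List.mem_toFinset.mpr hp)).trans hPK
        rw [hN, Nat.lt_succ_iff]
        exact_mod_cast h1
      rw [Set.indicator_of_mem hmem]
      have hbig : L ^ (32 : ℝ) ≤ (n : ℝ) ^ (32 / L) := by
        calc L ^ (32 : ℝ) = (P ^ Real.log L) ^ (32 / L) := by
              rw [← Real.rpow_mul hPpos.le, Real.rpow_def_of_pos hPpos,
                Real.rpow_def_of_pos hLpos, ← hLdef]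
              congr 1
              field_simp
          _ ≤ (n : ℝ) ^ (32 / L) :=
              Real.rpow_le_rpow (by positivity) hn.le (by positivity)
      rw [hs, Real.rpow_add hn0, Real.rpow_neg_one, Real.rpow_neg hLpos.le, one_div, mul_assoc]
      refine le_mul_of_one_le_right (by positivity) ?_
      rw [← div_eq_mul_inv, one_le_div (by positivity)]
      exact hbig
    · refine mul_nonneg (Set.indicator_nonneg (fun n _ => ?_) n) (by positivity)
      positivity
  have hnn : ∀ n : ℕ, 0 ≤ (if P ^ Real.log L < (n : ℝ) ∧ ∀ p ∈ n.primeFactors, (p : ℝ) ≤ P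
      then (1 : ℝ) / n else 0) := by
    intro n
    split_ifs <;> positivity
  calc _ ≤ (∏ p ∈ Nat.primesLE (2 ^ K), (1 - (p : ℝ) ^ s)⁻¹) * L ^ (-32 : ℝ) :=
        (Summable.of_nonneg_of_le hnn hle hind'.summable).tsum_le_of_sum_le
          fun t => (Finset.sum_le_sum fun n _ => hle n).trans
            (sum_le_hasSum t (fun n _ => (hnn n).trans (hle n)) hind')
    _ ≤ Real.exp (4 * (16 + 256 * Real.exp 64)) * L ^ (32 : ℝ) * L ^ (-32 : ℝ) := by gcongr
    _ = Real.exp (4 * (16 + 256 * Real.exp 64)) * 1 := by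
        rw [mul_assoc, ← Real.rpow_add hLpos]
        norm_num
    _ ≤ _ := by
        gcongr
        exact Real.one_le_rpow (by linarith) (by norm_num)
end

section
/- Let x be large and y ≤ x with x/y ≤ exp(√(log log x)), and set K = ⌊log log log x⌋ and z = x^{e^{-(K+1)}}. Then Ψ(x+y, z) − Ψ(x, z) ≪ y / log x, where Ψ(u, z) = #{n ≤ u : every prime factor of n is ≤ z}. -/
open scoped Classical

/-- `Ψ(u, z)`: the number of `z`-smooth positive integers up to `u`. -/
noncomputable def smoothCount (u z : ℝ) : ℕ :=
  ((Finset.Icc 1 ⌊u⌋₊).filter (fun n => ∀ p : ℕ, p ∈ n.primeFactors → (p : ℝ) ≤ z)).card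

open Real Finset in
/-- The Chebyshev bound for the number of primes in a dyadic interval. -/
lemma card_primes_dyadic_mul_le (s : Finset ℕ) (k : ℕ)
    (hs : ∀ p ∈ s, p.Prime ∧ 2 ^ k ≤ p ∧ p < 2 ^ (k + 1)) :
    (#s : ℝ) * k ≤ 4 * 2 ^ k := by
  have hlog2 : 0 < log 2 := log_pos one_lt_two
  have hlower : (#s : ℝ) * (k * log 2) ≤ ∑ p ∈ s, log p := by
    rw [← nsmul_eq_mul]
    refine card_nsmul_le_sum _ _ _ fun p hp ↦ ?_
    rw [← log_pow]
    exact log_le_log (by positivity) (mod_cast (hs p hp).2.1)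
  have hupper : ∑ p ∈ s, log p ≤ Chebyshev.theta ((2 ^ (k + 1) : ℕ) : ℝ) := by
    rw [Chebyshev.theta_eq_sum_primesLE_log]
    refine sum_le_sum_of_subset_of_nonneg (fun p hp ↦ ?_) fun p _ _ ↦ log_natCast_nonneg p
    exact Nat.mem_primesLE.2 ⟨(hs p hp).2.2.le, (hs p hp).1⟩
  have htheta := Chebyshev.theta_le_log4_mul_x (x := ((2 ^ (k + 1) : ℕ) : ℝ)) (by positivity)
  have h4 : log 4 = 2 * log 2 := by
    rw [show (4 : ℝ) = 2 ^ 2 by norm_num, log_pow]; norm_num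
  rw [h4] at htheta
  push_cast at htheta hupper
  refine le_of_mul_le_mul_right ?_ hlog2
  calc (#s : ℝ) * k * log 2 ≤ 2 * log 2 * 2 ^ (k + 1) := by linarith
    _ = 4 * 2 ^ k * log 2 := by ring

open Real Finset in
lemma sum_primes_dyadic_rpow_le {δ : ℝ} (hδ : δ ≤ 1) (s : Finset ℕ) {k : ℕ} (hk : 0 < k)
    (hs : ∀ p ∈ s, p.Prime ∧ 2 ^ k ≤ p ∧ p < 2 ^ (k + 1)) :
    ∑ p ∈ s, (p : ℝ) ^ (-(1 - δ)) ≤ 4 / k * (2 : ℝ) ^ (k * δ) := by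
  have hkR : (0 : ℝ) < k := mod_cast hk
  have hterm : ∀ p ∈ s, (p : ℝ) ^ (-(1 - δ)) ≤ ((2 : ℝ) ^ k) ^ (-(1 - δ)) := fun p hp ↦
    rpow_le_rpow_of_nonpos (by positivity) (mod_cast (hs p hp).2.1) (by linarith)
  have hpow : ((2 : ℝ) ^ k) ^ (-(1 - δ)) * 2 ^ k = (2 : ℝ) ^ (k * δ) := by
    rw [← rpow_natCast, ← rpow_mul zero_le_two, ← rpow_add zero_lt_two]
    congr 1; ring
  have hcard := card_primes_dyadic_mul_le s k hs
  calc ∑ p ∈ s, (p : ℝ) ^ (-(1 - δ)) ≤ #s * ((2 : ℝ) ^ k) ^ (-(1 - δ)) := by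
        rw [← nsmul_eq_mul]; exact sum_le_card_nsmul _ _ _ hterm
    _ ≤ (4 * 2 ^ k / k) * ((2 : ℝ) ^ k) ^ (-(1 - δ)) := by
        gcongr
        rwa [le_div_iff₀ hkR]
    _ = 4 / k * (2 : ℝ) ^ (k * δ) := by rw [← hpow]; ring

/-- Chord bound for the convex function `t ↦ b ^ t` on `[0, M]`. -/
lemma rpow_nat_mul_le_one_add {b δ : ℝ} (hb : 0 < b) {k M : ℕ} (hk : k ≤ M) (hM : 0 < M) :
    b ^ (k * δ) ≤ 1 + k / M * b ^ (M * δ) := by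
  have hMR : (0 : ℝ) < M := mod_cast hM
  have ht : (k : ℝ) / M ≤ 1 := (div_le_one hMR).2 (mod_cast hk)
  have hconv := convexOn_exp.2 (Set.mem_univ 0) (Set.mem_univ (Real.log b * (M * δ)))
    (sub_nonneg.2 ht) (by positivity : (0 : ℝ) ≤ k / M) (by ring)
  rw [Real.rpow_def_of_pos hb, Real.rpow_def_of_pos hb]
  have harg : (1 - (k : ℝ) / M) • (0 : ℝ) + ((k : ℝ) / M) • (Real.log b * (M * δ))
      = Real.log b * (k * δ) := by
    simp only [smul_eq_mul]; field_simp; ring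
  rw [harg] at hconv
  refine hconv.trans ?_
  simp only [smul_eq_mul, Real.exp_zero, mul_one]
  have : (0 : ℝ) ≤ k / M := by positivity
  linarith

open Real Finset in
lemma sum_primesLE_rpow_le {δ : ℝ} (hδ0 : 0 ≤ δ) (hδ : δ ≤ 1) {N : ℕ} (hN : 2 ≤ N) :
    ∑ p ∈ Nat.primesLE N, (p : ℝ) ^ (-(1 - δ)) ≤
      4 * (1 + log (Nat.log 2 N)) + 4 * (N : ℝ) ^ δ := by
  set M := Nat.log 2 N with hM
  have hMpos : 0 < M := Nat.log_pos one_lt_two hN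
  have hMR : (0 : ℝ) < M := mod_cast hMpos
  have hmaps : ∀ p ∈ Nat.primesLE N, Nat.log 2 p ∈ Icc 1 M := fun p hp ↦ by
    obtain ⟨hpN, hp⟩ := Nat.mem_primesLE.1 hp
    exact mem_Icc.2 ⟨Nat.log_pos one_lt_two hp.two_le, Nat.log_mono_right hpN⟩
  have h2M : (2 : ℝ) ^ (M * δ) ≤ (N : ℝ) ^ δ := by
    rw [rpow_mul zero_le_two, rpow_natCast]
    exact rpow_le_rpow (by positivity) (mod_cast Nat.pow_log_le_self 2 (by lia)) hδ0
  rw [← sum_fiberwise_of_maps_to hmaps]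
  calc _ ≤ ∑ k ∈ Icc 1 M, (4 * (k : ℝ)⁻¹ + 4 / M * (N : ℝ) ^ δ) := by
        refine sum_le_sum fun k hk ↦ ?_
        obtain ⟨hk1, hkM⟩ := mem_Icc.1 hk
        have hkR : (0 : ℝ) < k := mod_cast hk1
        calc _ ≤ 4 / k * (2 : ℝ) ^ (k * δ) := by
              refine sum_primes_dyadic_rpow_le hδ _ hk1 fun p hp ↦ ?_
              obtain ⟨hpN, rfl⟩ := mem_filter.1 hp
              have hp := (Nat.mem_primesLE.1 hpN).2
              exact ⟨hp, Nat.pow_log_le_self 2 hp.ne_zero, Nat.lt_pow_succ_log_self one_lt_two p⟩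
          _ ≤ 4 / k * (1 + k / M * (2 : ℝ) ^ (M * δ)) := by
              gcongr
              exact rpow_nat_mul_le_one_add zero_lt_two hkM hMpos
          _ = 4 * (k : ℝ)⁻¹ + 4 / M * (2 : ℝ) ^ (M * δ) := by field_simp
          _ ≤ _ := by gcongr
    _ = 4 * ∑ k ∈ Icc 1 M, (k : ℝ)⁻¹ + 4 * (N : ℝ) ^ δ := by
        rw [sum_add_distrib, ← mul_sum, sum_const, Nat.card_Icc, nsmul_eq_mul]
        simp only [Nat.add_sub_cancel]
        field_simp
    _ ≤ _ := by
        have := harmonic_le_one_add_log M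
        rw [harmonic_eq_sum_Icc] at this
        push_cast at this
        gcongr

lemma inv_one_sub_le_exp_four_mul {t : ℝ} (ht0 : 0 ≤ t) (ht : t ≤ 3 / 4) :
    (1 - t)⁻¹ ≤ Real.exp (4 * t) := by
  have h := Real.add_one_le_exp (4 * t)
  refine le_trans ?_ h
  rw [inv_le_iff_one_le_mul₀ (by linarith)]
  nlinarith

open Real in
/-- The completely multiplicative function `n ↦ n ^ (-σ)`. -/
noncomputable def natRpowNegHom (σ : ℝ) : ℕ →* ℝ where
  toFun n := (n : ℝ) ^ (-σ)
  map_one' := by simp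
  map_mul' m n := by
    push_cast
    exact mul_rpow (Nat.cast_nonneg m) (Nat.cast_nonneg n)

open Real Finset in
/-- The Rankin upper bound for the number of smooth numbers. -/
lemma smoothCount_le_rpow_mul_exp {σ X z : ℝ} (hσ : 3 / 4 ≤ σ) (hX : 0 ≤ X) :
    (smoothCount X z : ℝ) ≤
      X ^ σ * exp (4 * ∑ p ∈ Nat.primesLE ⌊z⌋₊, (p : ℝ) ^ (-σ)) := by
  have hprime {p : ℕ} (hp : p.Prime) : (p : ℝ) ^ (-σ) ≤ 3 / 4 := by
    calc (p : ℝ) ^ (-σ) ≤ (2 : ℝ) ^ (-σ) :=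
          rpow_le_rpow_of_nonpos two_pos (mod_cast hp.two_le) (by linarith)
      _ ≤ (2 : ℝ) ^ (-(1 / 2 : ℝ)) := rpow_le_rpow_of_exponent_le one_le_two (by linarith)
      _ ≤ 3 / 4 := by
          rw [rpow_neg zero_le_two, ← sqrt_eq_rpow, inv_le_comm₀ (by positivity) (by norm_num)]
          exact le_sqrt_of_sq_le (by norm_num)
  obtain ⟨-, hsum⟩ :=
    EulerProduct.summable_and_hasSum_factoredNumbers_prod_filter_prime_geometric
      (f := natRpowNegHom σ)
      (fun {p} hp ↦ by
        change ‖(p : ℝ) ^ (-σ)‖ < 1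
        rw [norm_of_nonneg (by positivity)]
        linarith [hprime hp]) (Nat.primesLE ⌊z⌋₊)
  set S := (Icc 1 ⌊X⌋₊).filter (fun n => ∀ p : ℕ, p ∈ n.primeFactors → (p : ℝ) ≤ z) with hS
  have hfac : ∀ n ∈ S, n ∈ Nat.factoredNumbers (Nat.primesLE ⌊z⌋₊) := fun n hn ↦ by
    obtain ⟨hn, hnz⟩ := mem_filter.1 hn
    refine Nat.mem_factoredNumbers_of_primeFactors_subset
      (Nat.one_le_iff_ne_zero.1 (mem_Icc.1 hn).1) fun p hp ↦ ?_
    exact Nat.mem_primesLE.2 ⟨Nat.le_floor (hnz p hp), Nat.prime_of_mem_primeFactors hp⟩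
  have hsumS : ∑ n ∈ S, (n : ℝ) ^ (-σ) ≤
      ∏ p ∈ Nat.primesLE ⌊z⌋₊ with p.Prime, (1 - (p : ℝ) ^ (-σ))⁻¹ := by
    rw [← sum_attach]
    let e : S ↪ Nat.factoredNumbers (Nat.primesLE ⌊z⌋₊) :=
      ⟨fun n ↦ ⟨n, hfac n n.2⟩, fun a b h ↦ Subtype.ext (Subtype.mk.inj h)⟩
    have h := sum_le_hasSum (S.attach.map e) (fun m _ ↦ ?_) hsum
    · rwa [sum_map] at h
    · exact rpow_nonneg (Nat.cast_nonneg _) _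
  have hprod : ∏ p ∈ Nat.primesLE ⌊z⌋₊ with p.Prime, (1 - (p : ℝ) ^ (-σ))⁻¹ ≤
      exp (4 * ∑ p ∈ Nat.primesLE ⌊z⌋₊, (p : ℝ) ^ (-σ)) := by
    rw [filter_true_of_mem fun p hp ↦ (Nat.mem_primesLE.1 hp).2, mul_sum, exp_sum]
    refine prod_le_prod (fun p hp ↦ ?_) fun p hp ↦ ?_
    all_goals have := hprime (Nat.mem_primesLE.1 hp).2
    · exact inv_nonneg.2 (by linarith)
    · exact inv_one_sub_le_exp_four_mul (by positivity) this
  have hcount : (smoothCount X z : ℝ) ≤ X ^ σ * ∑ n ∈ S, (n : ℝ) ^ (-σ) := by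
    rw [smoothCount, ← hS, card_eq_sum_ones, Nat.cast_sum, mul_sum]
    refine sum_le_sum fun n hn ↦ ?_
    obtain ⟨hn1, hnX⟩ := mem_Icc.1 (mem_filter.1 hn).1
    have hn0 : (0 : ℝ) < n := mod_cast hn1
    rw [rpow_neg hn0.le, ← div_eq_mul_inv, Nat.cast_one, one_le_div (by positivity)]
    exact rpow_le_rpow hn0.le ((Nat.le_floor_iff hX).1 hnX) (by linarith)
  exact hcount.trans (mul_le_mul_of_nonneg_left (hsumS.trans hprod) (by positivity))

lemma smoothCount_mono_left {a b : ℝ} (h : a ≤ b) (z : ℝ) : smoothCount a z ≤ smoothCount b z :=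
  Finset.card_le_card <| Finset.filter_subset_filter _ <|
    Finset.Icc_subset_Icc_right <| Nat.floor_mono h

open Real in
/-- The Rankin bound at `σ = 1 - c / log z`, with `z = x ^ (1 / u)`. -/
lemma smoothCount_two_mul_le {c u x : ℝ} (hc : 0 ≤ c) (hu : 1 ≤ u) (hx : 1 ≤ x)
    (hcu : 4 * c * u ≤ log x) (hlog : 1 ≤ log x / u) :
    (smoothCount (2 * x) (x ^ u⁻¹) : ℝ) ≤
      2 * x * exp (-(c * u)) * exp (32 + 16 * log (log x) + 16 * exp c) := by
  have hu0 : 0 < u := by linarith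
  have hx0 : 0 < x := by linarith
  set z := x ^ u⁻¹ with hz
  have hz0 : 0 < z := by positivity
  have hlogz : log z = log x / u := by rw [hz, log_rpow hx0]; ring
  have hlx : 0 < log x := by
    have := (le_div_iff₀ hu0).1 hlog; linarith
  set δ := c / log z with hδ
  have hδeq : δ = c * u / log x := by rw [hδ, hlogz]; field_simp
  have hδ0 : 0 ≤ δ := by rw [hδeq]; positivity
  have hδ4 : δ ≤ 1 / 4 := by rw [hδeq, div_le_iff₀ hlx]; linarith
  have hz2 : 2 ≤ z := by
    rw [← exp_log hz0, hlogz]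
    linarith [add_one_le_exp (log x / u)]
  have hN : 2 ≤ ⌊z⌋₊ := Nat.le_floor (mod_cast hz2)
  have hzδ : ((⌊z⌋₊ : ℕ) : ℝ) ^ δ ≤ exp c := by
    calc ((⌊z⌋₊ : ℕ) : ℝ) ^ δ ≤ z ^ δ := rpow_le_rpow (by positivity) (Nat.floor_le hz0.le) hδ0
      _ = exp c := by
        rw [rpow_def_of_pos hz0, hδ, mul_div_cancel₀ _ (by rw [hlogz]; positivity)]
  have hM : log (Nat.log 2 ⌊z⌋₊) ≤ 1 + log (log x) := by
    have hMpos : (0 : ℝ) < Nat.log 2 ⌊z⌋₊ := mod_cast Nat.log_pos one_lt_two hN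
    have h1 : (Nat.log 2 ⌊z⌋₊ : ℝ) * log 2 ≤ log x := by
      rw [← log_pow]
      refine log_le_log (by positivity) ?_
      calc (2 : ℝ) ^ Nat.log 2 ⌊z⌋₊ ≤ (⌊z⌋₊ : ℝ) :=
            mod_cast Nat.pow_log_le_self 2 (by lia)
        _ ≤ z := Nat.floor_le hz0.le
        _ ≤ x ^ (1 : ℝ) := rpow_le_rpow_of_exponent_le hx (inv_le_one_of_one_le₀ hu)
        _ = x := rpow_one x
    have h2 : (Nat.log 2 ⌊z⌋₊ : ℝ) ≤ exp 1 * log x := by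
      have := log_two_gt_d9
      have := exp_one_gt_d9
      nlinarith
    calc log (Nat.log 2 ⌊z⌋₊) ≤ log (exp 1 * log x) := log_le_log hMpos h2
      _ = 1 + log (log x) := by rw [log_mul (exp_pos 1).ne' hlx.ne', log_exp]
  have hsum := sum_primesLE_rpow_le hδ0 (by linarith) hN
  have hrankin := smoothCount_le_rpow_mul_exp (σ := 1 - δ) (X := 2 * x) (z := z) (by linarith)
    (by linarith)
  have hpow : (2 * x) ^ (1 - δ) ≤ 2 * x * exp (-(c * u)) := by
    have hx2 : 0 < 2 * x := by linarith
    rw [sub_eq_add_neg, rpow_add hx2, rpow_one]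
    gcongr
    calc (2 * x) ^ (-δ) ≤ x ^ (-δ) :=
          rpow_le_rpow_of_nonpos hx0 (by linarith) (by linarith)
      _ = exp (-(c * u)) := by
        rw [rpow_def_of_pos hx0, hδeq]; congr 1; field_simp
  refine hrankin.trans (mul_le_mul hpow (exp_le_exp.2 ?_) (exp_pos _).le (by positivity))
  linarith

open Real Filter in
theorem stmt_13 : ∃ C > (0 : ℝ), ∃ x₀ : ℝ, ∀ x y : ℝ, x₀ ≤ x → 0 < y → y ≤ x →
    x / y ≤ Real.exp (Real.sqrt (Real.log (Real.log x))) →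
    (smoothCount (x + y) (x ^ Real.exp (-(((⌊Real.log (Real.log (Real.log x))⌋₊ : ℝ)) + 1))) : ℝ)
      - smoothCount x (x ^ Real.exp (-(((⌊Real.log (Real.log (Real.log x))⌋₊ : ℝ)) + 1)))
      ≤ C * y / Real.log x := by
  have hlarge : ∀ᶠ x : ℝ in atTop, 1 ≤ x ∧ 0 < log x ∧ exp 1 ≤ log (log x) ∧
      72 * (exp 1 * log (log x)) ≤ log x := by
    have hloglog : Tendsto (fun x : ℝ ↦ log (log x)) atTop atTop :=
      tendsto_log_atTop.comp tendsto_log_atTop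
    have hlittle : ∀ᶠ t : ℝ in atTop, ‖log t‖ ≤ (72 * exp 1)⁻¹ * ‖t‖ :=
      isLittleO_log_id_atTop.bound (by positivity)
    filter_upwards [eventually_ge_atTop 1, tendsto_log_atTop.eventually_gt_atTop 0,
      hloglog.eventually_ge_atTop (exp 1), tendsto_log_atTop.eventually hlittle]
      with x h1 h2 h3 h4
    refine ⟨h1, h2, h3, ?_⟩
    rw [norm_of_nonneg ((exp_pos 1).le.trans h3), norm_of_nonneg h2.le,
      inv_mul_eq_div, le_div_iff₀ (by positivity)] at h4
    linarith
  obtain ⟨x₀, hx₀⟩ := eventually_atTop.1 hlarge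
  refine ⟨2 * exp (32 + 16 * exp 18), by positivity, x₀, fun x y hx hy hyx hxy ↦ ?_⟩
  obtain ⟨hx1, hlx, hll, hbig⟩ := hx₀ x hx
  set ℓ := log (log x) with hℓ
  set K := ⌊log ℓ⌋₊ with hK
  have hℓ1 : 1 ≤ ℓ := by linarith [add_one_le_exp (1 : ℝ)]
  have hℓ0 : 0 < ℓ := by linarith
  set u := exp ((K : ℝ) + 1) with hu
  have hu_ge : ℓ ≤ u := by
    calc ℓ = exp (log ℓ) := (exp_log hℓ0).symm
      _ ≤ u := exp_le_exp.2 (Nat.lt_floor_add_one _).le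
  have hu_le : u ≤ exp 1 * ℓ := by
    rw [hu, exp_add, mul_comm]
    gcongr
    calc exp (K : ℝ) ≤ exp (log ℓ) := exp_le_exp.2 (Nat.floor_le (log_nonneg hℓ1))
      _ = ℓ := exp_log hℓ0
  have hu0 : 0 < u := exp_pos _
  rw [exp_neg, ← hu]
  have hbound := smoothCount_two_mul_le (c := 18) (u := u) (x := x) (by norm_num)
    (by linarith) hx1 (by linarith) (by rw [le_div_iff₀ hu0]; linarith)
  have hmono : (smoothCount (x + y) (x ^ u⁻¹) : ℝ) ≤ smoothCount (2 * x) (x ^ u⁻¹) :=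
    mod_cast smoothCount_mono_left (by linarith) _
  have hxle : x ≤ exp ℓ * y := by
    rw [div_le_iff₀ hy] at hxy
    refine hxy.trans ?_
    gcongr
    exact sqrt_le_iff.2 ⟨hℓ0.le, by nlinarith⟩
  have hexpℓ : exp ℓ = log x := exp_log hlx
  calc _ ≤ (smoothCount (2 * x) (x ^ u⁻¹) : ℝ) := by
        linarith [Nat.cast_nonneg (α := ℝ) (smoothCount x (x ^ u⁻¹))]
    _ ≤ 2 * x * exp (-(18 * u)) * exp (32 + 16 * ℓ + 16 * exp 18) := hbound
    _ ≤ 2 * (exp ℓ * y) * exp (-(18 * ℓ)) * exp (32 + 16 * ℓ + 16 * exp 18) := by gcongr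
    _ = 2 * exp (32 + 16 * exp 18) * y * exp (-ℓ) := by
        have : exp ℓ * exp (-(18 * ℓ)) * exp (32 + 16 * ℓ + 16 * exp 18) =
            exp (32 + 16 * exp 18) * exp (-ℓ) := by
          simp only [← exp_add]; congr 1; ring
        linear_combination 2 * y * this
    _ = 2 * exp (32 + 16 * exp 18) * y / log x := by
        rw [exp_neg, hexpℓ]; ring
end
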